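/- Let H₀ be an n×n complex diagonal matrix with trace 0, H an n×n real diagonal matrix with pairwise distinct diagonal entries, O(H₀) = {g H₀ g⁻¹ : g ∈ GL(n,ℂ)}, and f_H(x) = trace(xH). Call c ∈ ℂ a regular value if c ≠ f_H(y) for every diagonal matrix y ∈ O(H₀). Then for any two regular values c₁, c₂ ∈ ℂ, the level sets {x ∈ O(H₀) : f_H(x) = c₁} and {x ∈ O(H₀) : f_H(x) = c₂} (with the subspace topology from the matrix space) are homeomorphic. -/

import Mathlib

attribute [local instance] Matrix.frobeniusNormedAddCommGroup

/-- The adjoint orbit of the diagonal matrix `H₀ = diagonal d`. -/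
def adjointOrbit (n : ℕ) (d : Fin n → ℂ) : Set (Matrix (Fin n) (Fin n) ℂ) :=
  {x | ∃ g : GL (Fin n) ℂ, x = (g : Matrix (Fin n) (Fin n) ℂ) * Matrix.diagonal d *
        ((g⁻¹ : GL (Fin n) ℂ) : Matrix (Fin n) (Fin n) ℂ)}

open Set

section Flow

variable {E : Type*} [NormedAddCommGroup E] [NormedSpace ℝ E]

/-- `γ` is an integral curve of the autonomous vector field `v` on the time interval `[0, 1]`. -/
def IsUnitIntegralCurve (v : E → E) (γ : ℝ → E) : Prop :=
  ∀ t ∈ Icc (0 : ℝ) 1, HasDerivAt γ (v (γ t)) t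

lemma IsUnitIntegralCurve.continuousOn {v : E → E} {γ : ℝ → E} (hγ : IsUnitIntegralCurve v γ) :
    ContinuousOn γ (Icc 0 1) :=
  fun t ht => (hγ t ht).continuousAt.continuousWithinAt

lemma IsUnitIntegralCurve.reverse {v : E → E} {γ : ℝ → E} (hγ : IsUnitIntegralCurve v γ) :
    IsUnitIntegralCurve (-v) (fun t => γ (1 - t)) := by
  intro t ht
  have h := hγ (1 - t) ⟨by linarith [ht.2], by linarith [ht.1]⟩
  simpa [Function.comp_def] using HasDerivAt.scomp t h ((hasDerivAt_id t).const_sub 1)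

lemma exists_isUnitIntegralCurve [CompleteSpace E] {v : E → E} {K M : NNReal}
    (hv : LipschitzWith K v) (hM : ∀ x, ‖v x‖ ≤ M) (x : E) :
    ∃ γ : ℝ → E, γ 0 = x ∧ IsUnitIntegralCurve v γ := by
  have hPL : IsPicardLindelof (fun _ => v) (tmin := -1) (tmax := 2)
      ⟨0, by norm_num, by norm_num⟩ x (2 * M) 0 M K :=
    .of_time_independent (fun y _ => hM y) hv.lipschitzOnWith (by norm_num; linarith)
  obtain ⟨γ, h0, hγ⟩ := hPL.exists_eq_forall_mem_Icc_hasDerivWithinAt₀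
  exact ⟨γ, h0, fun t ht => (hγ t ⟨by linarith [ht.1], by linarith [ht.2]⟩).hasDerivAt
    (Icc_mem_nhds (by linarith [ht.1]) (by linarith [ht.2]))⟩

lemma IsUnitIntegralCurve.dist_le {v : E → E} {K : NNReal} (hv : LipschitzWith K v)
    {γ δ : ℝ → E} (hγ : IsUnitIntegralCurve v γ) (hδ : IsUnitIntegralCurve v δ) :
    dist (γ 1) (δ 1) ≤ Real.exp K * dist (γ 0) (δ 0) := by
  have h := dist_le_of_trajectories_ODE (v := fun _ => v) (fun _ => hv) hγ.continuousOn
    (fun t ht => (hγ t (Ico_subset_Icc_self ht)).hasDerivWithinAt) hδ.continuousOn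
    (fun t ht => (hδ t (Ico_subset_Icc_self ht)).hasDerivWithinAt) le_rfl 1 (by simp)
  simpa [mul_comm] using h

/-- If the time-one flow of a bounded Lipschitz vector field maps `S` into `T`, and the reversed
flow maps `T` into `S`, then `S` and `T` are homeomorphic. -/
lemma nonempty_homeomorph_of_unit_flow [CompleteSpace E] {v : E → E} {K M : NNReal}
    (hv : LipschitzWith K v) (hM : ∀ x, ‖v x‖ ≤ M) {S T : Set E}
    (hST : ∀ γ, IsUnitIntegralCurve v γ → γ 0 ∈ S → γ 1 ∈ T)
    (hTS : ∀ γ, IsUnitIntegralCurve (-v) γ → γ 0 ∈ T → γ 1 ∈ S) :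
    Nonempty (S ≃ₜ T) := by
  have hv' : LipschitzWith K (-v) := hv.neg
  choose φ hφ0 hφ using exists_isUnitIntegralCurve hv hM
  choose ψ hψ0 hψ using exists_isUnitIntegralCurve hv' (M := M) (by simpa using hM)
  have hcont : ∀ {w : E → E} {χ : E → ℝ → E}, LipschitzWith K w → (∀ x, χ x 0 = x) →
      (∀ x, IsUnitIntegralCurve w (χ x)) → Continuous fun x => χ x 1 := by
    intro w χ hw h0 h
    refine (LipschitzWith.of_dist_le_mul (K := (Real.exp K).toNNReal) ?_).continuous
    intro x y
    rw [Real.coe_toNNReal _ (Real.exp_pos _).le]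
    simpa [h0] using (h x).dist_le hw (h y)
  have hinv : ∀ {w : E → E} {γ δ : ℝ → E}, LipschitzWith K (-w) → IsUnitIntegralCurve w γ →
      IsUnitIntegralCurve (-w) δ → δ 0 = γ 1 → δ 1 = γ 0 := by
    intro w γ δ hw hγ hδ h
    have := hδ.dist_le hw hγ.reverse
    simp only [sub_zero, h, dist_self, mul_zero, sub_self] at this
    exact dist_le_zero.1 this
  exact ⟨{
    toFun := fun x => ⟨φ x 1, hST _ (hφ x) (by simp [hφ0])⟩
    invFun := fun y => ⟨ψ y 1, hTS _ (hψ y) (by simp [hψ0])⟩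
    left_inv := fun x => Subtype.ext <| by
      simpa [hφ0] using hinv hv' (hφ x) (hψ (φ x 1)) (hψ0 _)
    right_inv := fun y => Subtype.ext <| by
      simpa [hψ0] using hinv (w := -v) (by simpa using hv) (hψ y)
        (by simpa using hφ (ψ y 1)) (hφ0 _)
    continuous_toFun := ((hcont hv hφ0 hφ).comp continuous_subtype_val).subtype_mk _
    continuous_invFun := ((hcont hv' hψ0 hψ).comp continuous_subtype_val).subtype_mk _ }⟩

end Flow

section Orbit

open Polynomial

/-- Two finite families of complex numbers with the same polynomial power sums agree up to a
permutation. -/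
lemma exists_perm_of_sum_eval_eq {n : ℕ} {d e : Fin n → ℂ}
    (h : ∀ q : ℂ[X], ∑ i, q.eval (e i) = ∑ i, q.eval (d i)) :
    ∃ σ : Equiv.Perm (Fin n), ∀ i, d (σ i) = e i := by
  classical
  have hcard : ∀ c : ℂ, Nonempty ({i // e i = c} ≃ {i // d i = c}) := by
    intro c
    let s : Finset ℂ := Finset.univ.image d ∪ Finset.univ.image e
    let q : ℂ[X] := Lagrange.interpolate s id fun z => if z = c then 1 else 0
    have hq : ∀ z ∈ s, q.eval z = if z = c then 1 else 0 := fun z hz =>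
      Lagrange.eval_interpolate_at_node (v := id) _ (Function.injective_id.injOn) hz
    have hsum := h q
    rw [Finset.sum_congr rfl fun i _ => hq (e i) (by simp [s]),
      Finset.sum_congr rfl fun i _ => hq (d i) (by simp [s])] at hsum
    simp only [Finset.sum_boole, Nat.cast_inj] at hsum
    exact Fintype.card_eq.1 (by simpa [Fintype.card_subtype] using hsum)
  exact ⟨Equiv.ofFiberEquiv fun c => (hcard c).some, fun i => Equiv.ofFiberEquiv_map _ i⟩

/-- A complex matrix annihilated by a squarefree polynomial is diagonalizable. -/
lemma exists_eq_conj_diagonal_of_squarefree {n : ℕ} {x : Matrix (Fin n) (Fin n) ℂ} {p : ℂ[X]}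
    (hp : Squarefree p) (hx : aeval x p = 0) : ∃ e : Fin n → ℂ, x ∈ adjointOrbit n e := by
  let f : Module.End ℂ (Fin n → ℂ) := Matrix.toLinAlgEquiv' x
  have hf : f.IsSemisimple := by
    refine Module.End.isSemisimple_of_squarefree_aeval_eq_zero hp ?_
    rw [show f = (Matrix.toLinAlgEquiv' : _ ≃ₐ[ℂ] _) x from rfl, Polynomial.aeval_algEquiv]
    simp [hx]
  let s : Set (Fin n → ℂ) := ⋃ μ : ℂ, (f.eigenspace μ : Set (Fin n → ℂ))
  have hs : ⊤ ≤ Submodule.span ℂ s := by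
    rw [Submodule.span_iUnion, ← hf.iSup_eigenspace_eq_top]
    simp
  let b₀ := Module.Basis.ofSpan hs
  let b : Module.Basis (Fin n) ℂ (Fin n → ℂ) :=
    b₀.reindex (b₀.indexEquiv (Pi.basisFun ℂ (Fin n)))
  have hb : ∀ i, ∃ μ : ℂ, x.mulVec (b i) = μ • b i := by
    intro i
    have : b i ∈ s := Module.Basis.ofSpan_subset hs (by simp [b, b₀])
    obtain ⟨μ, hμ⟩ := mem_iUnion.1 this
    exact ⟨μ, by simpa [f] using Module.End.mem_eigenspace_iff.1 hμ⟩
  choose e he using hb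
  let P : Matrix (Fin n) (Fin n) ℂ := (Pi.basisFun ℂ (Fin n)).toMatrix b
  let Q : Matrix (Fin n) (Fin n) ℂ := b.toMatrix (Pi.basisFun ℂ (Fin n))
  have hPQ : P * Q = 1 := Module.Basis.toMatrix_mul_toMatrix_flip _ _
  have hQP : Q * P = 1 := Module.Basis.toMatrix_mul_toMatrix_flip _ _
  have hxP : x * P = P * Matrix.diagonal e := by
    ext i j
    rw [Matrix.mul_diagonal, Matrix.mul_apply]
    have := congrFun (he j) i
    simpa [P, Module.Basis.toMatrix_apply, Matrix.mulVec, dotProduct, mul_comm] using this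
  refine ⟨e, ⟨P, Q, hPQ, hQP⟩, ?_⟩
  change x = P * Matrix.diagonal e * Q
  rw [← hxP, mul_assoc, hPQ, mul_one]

lemma aeval_mem_adjointOrbit {n : ℕ} {d : Fin n → ℂ} {x : Matrix (Fin n) (Fin n) ℂ}
    (hx : x ∈ adjointOrbit n d) (q : ℂ[X]) :
    aeval x q ∈ adjointOrbit n fun i => q.eval (d i) := by
  obtain ⟨g, rfl⟩ := hx
  refine ⟨g, ?_⟩
  induction q using Polynomial.induction_on' with
  | add p q hp hq =>
    simp only [map_add, hp, hq, eval_add, ← Matrix.diagonal_add, mul_add, add_mul]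
  | monomial k a =>
    simp only [aeval_monomial, eval_monomial]
    rw [Units.conj_pow, Matrix.diagonal_pow, ← Algebra.smul_def, ← smul_mul_assoc, ← mul_smul_comm]
    congr 2
    ext i j
    by_cases hij : i = j <;> simp [Matrix.diagonal, hij]

lemma trace_of_mem_adjointOrbit {n : ℕ} {d : Fin n → ℂ} {x : Matrix (Fin n) (Fin n) ℂ}
    (hx : x ∈ adjointOrbit n d) : x.trace = ∑ i, d i := by
  obtain ⟨g, rfl⟩ := hx
  rw [Matrix.trace_units_conj, Matrix.trace_diagonal]

lemma conj_mem_adjointOrbit {n : ℕ} {d : Fin n → ℂ} {x : Matrix (Fin n) (Fin n) ℂ}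
    (hx : x ∈ adjointOrbit n d) (g : GL (Fin n) ℂ) :
    (g : Matrix (Fin n) (Fin n) ℂ) * x * ((g⁻¹ : GL (Fin n) ℂ) : Matrix (Fin n) (Fin n) ℂ) ∈
      adjointOrbit n d := by
  obtain ⟨k, rfl⟩ := hx
  exact ⟨g * k, by simp only [mul_inv_rev, Units.val_mul, mul_assoc]⟩

lemma diagonal_comp_perm_mem_adjointOrbit {n : ℕ} (d : Fin n → ℂ) (σ : Equiv.Perm (Fin n)) :
    Matrix.diagonal (fun i => d (σ i)) ∈ adjointOrbit n d := by
  let P : Matrix (Fin n) (Fin n) ℂ := (1 : Matrix (Fin n) (Fin n) ℂ).submatrix σ (Equiv.refl _)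
  let Q : Matrix (Fin n) (Fin n) ℂ := (1 : Matrix (Fin n) (Fin n) ℂ).submatrix (Equiv.refl _) σ
  have hPQ : P * Q = 1 := by
    simp only [P, Q, Matrix.submatrix_mul_equiv, mul_one, Matrix.submatrix_one_equiv]
  have hQP : Q * P = 1 := by
    simp only [P, Q, Matrix.submatrix_mul_equiv, mul_one, Matrix.submatrix_one_equiv]
  refine ⟨⟨P, Q, hPQ, hQP⟩, ?_⟩
  change _ = P * (Matrix.diagonal d).submatrix (Equiv.refl _) (Equiv.refl _) * Q
  simp only [P, Q, Matrix.submatrix_mul_equiv, mul_one, one_mul]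
  exact (Matrix.submatrix_diagonal_equiv d σ).symm

/-- The product of the linear factors belonging to the distinct entries of `d`. -/
noncomputable def nodalPolynomial {n : ℕ} (d : Fin n → ℂ) : ℂ[X] :=
  Lagrange.nodal (Finset.univ.image d) id

/-- The orbit of a diagonal matrix is cut out by polynomial equations. -/
lemma mem_adjointOrbit_iff {n : ℕ} {d : Fin n → ℂ} {x : Matrix (Fin n) (Fin n) ℂ} :
    x ∈ adjointOrbit n d ↔ aeval x (nodalPolynomial d) = 0 ∧
      ∀ q : ℂ[X], (aeval x q).trace = ∑ i, q.eval (d i) := by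
  refine ⟨fun hx => ⟨?_, fun q => trace_of_mem_adjointOrbit (aeval_mem_adjointOrbit hx q)⟩, ?_⟩
  · obtain ⟨g, hg⟩ := aeval_mem_adjointOrbit hx (nodalPolynomial d)
    have : (fun i => (nodalPolynomial d).eval (d i)) = 0 := funext fun i =>
      Lagrange.eval_nodal_at_node (v := id) (Finset.mem_image_of_mem d (Finset.mem_univ i))
    simpa [this] using hg
  · rintro ⟨hp, hq⟩
    have hsq : Squarefree (nodalPolynomial d) := by
      rw [nodalPolynomial, Lagrange.nodal]
      exact (separable_prod_X_sub_C_iff'.2 (fun _ _ _ _ h => h)).squarefree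
    obtain ⟨e, he⟩ := exists_eq_conj_diagonal_of_squarefree hsq hp
    obtain ⟨σ, hσ⟩ := exists_perm_of_sum_eval_eq (d := d) (e := e) fun q => by
      rw [← hq q, trace_of_mem_adjointOrbit (aeval_mem_adjointOrbit he q)]
    obtain ⟨g, rfl⟩ := he
    exact conj_mem_adjointOrbit (funext hσ ▸ diagonal_comp_perm_mem_adjointOrbit d σ) g

lemma isClosed_adjointOrbit (n : ℕ) (d : Fin n → ℂ) : IsClosed (adjointOrbit n d) := by
  have : adjointOrbit n d = {x | aeval x (nodalPolynomial d) = 0} ∩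
      ⋂ q : ℂ[X], {x | (aeval x q).trace = ∑ i, q.eval (d i)} := by
    ext x
    simp [mem_adjointOrbit_iff]
  have hcont : ∀ q : ℂ[X], Continuous fun x : Matrix (Fin n) (Fin n) ℂ => aeval x q := fun q =>
    Polynomial.continuous_aeval q
  rw [this]
  exact (isClosed_eq (hcont _) continuous_const).inter
    (isClosed_iInter fun q => isClosed_eq (hcont q).matrix_trace continuous_const)

lemma det_sub_of_mem_adjointOrbit {n : ℕ} {d : Fin n → ℂ} {x : Matrix (Fin n) (Fin n) ℂ}
    (hx : x ∈ adjointOrbit n d) (w s : ℂ) :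
    (Matrix.scalar (Fin n) w - s • x).det = ∏ i, (w - s * d i) := by
  obtain ⟨g, rfl⟩ := hx
  have : Matrix.scalar (Fin n) w - s • ((g : Matrix (Fin n) (Fin n) ℂ) * Matrix.diagonal d *
      ((g⁻¹ : GL (Fin n) ℂ) : Matrix (Fin n) (Fin n) ℂ)) =
      g * Matrix.diagonal (fun i => w - s * d i) *
        ((g⁻¹ : GL (Fin n) ℂ) : Matrix (Fin n) (Fin n) ℂ) := by
    have h1 : Matrix.diagonal (fun i => w - s * d i) =
        Matrix.scalar (Fin n) w - s • Matrix.diagonal d := by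
      ext i j
      by_cases hij : i = j <;> simp [Matrix.diagonal, hij]
    rw [h1, mul_sub, sub_mul, (Matrix.scalar_commute w (fun _ => mul_comm _ _) _).symm.eq,
      Units.mul_inv_cancel_right, mul_smul_comm, smul_mul_assoc]
  rw [this, Matrix.det_units_conj, Matrix.det_diagonal]

end Orbit

section Lax

open Polynomial

variable {𝔸 : Type*} [NormedRing 𝔸] [NormedAlgebra ℝ 𝔸] [Algebra ℂ 𝔸]
  [ContinuousConstSMul ℂ 𝔸] [SMulCommClass ℝ ℂ 𝔸] {γ A : ℝ → 𝔸}

lemma hasDerivAt_aeval_of_lax {t : ℝ} (hγ : HasDerivAt γ (A t * γ t - γ t * A t) t) (q : ℂ[X]) :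
    HasDerivAt (fun s => aeval (γ s) q) (A t * aeval (γ t) q - aeval (γ t) q * A t) t := by
  have hpow : ∀ k : ℕ, HasDerivAt (fun s => γ s ^ k) (A t * γ t ^ k - γ t ^ k * A t) t := by
    intro k
    induction k with
    | zero => simpa using hasDerivAt_const t (1 : 𝔸)
    | succ k ih =>
      simp only [pow_succ]
      convert! ih.mul hγ using 1
      noncomm_ring
  induction q using Polynomial.induction_on' with
  | add p q hp hq =>
    simp only [map_add]
    convert! hp.add hq using 1
    noncomm_ring
  | monomial k a =>
    simp only [aeval_monomial, ← Algebra.smul_def]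
    convert! (hpow k).const_smul a using 1
    rw [smul_sub, mul_smul_comm, smul_mul_assoc]

lemma aeval_eq_zero_of_lax {C : ℝ} (hA : ∀ t, ‖A t‖ ≤ C)
    (hγ : ∀ t ∈ Icc (0 : ℝ) 1, HasDerivAt γ (A t * γ t - γ t * A t) t) {p : ℂ[X]}
    (h0 : aeval (γ 0) p = 0) {t : ℝ} (ht : t ∈ Icc (0 : ℝ) 1) : aeval (γ t) p = 0 := by
  have hder := fun s hs => hasDerivAt_aeval_of_lax (hγ s hs) p
  refine eq_zero_of_abs_deriv_le_mul_abs_self_of_eq_zero_right (K := 2 * C)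
    (fun s hs => (hder s hs).continuousAt.continuousWithinAt)
    (fun s hs => (hder s (Ico_subset_Icc_self hs)).hasDerivWithinAt) h0 ?_ t ht
  intro s _
  have h1 := norm_mul_le (A s) (aeval (γ s) p)
  have h2 := norm_mul_le (aeval (γ s) p) (A s)
  have h3 := norm_sub_le (A s * aeval (γ s) p) (aeval (γ s) p * A s)
  linarith [mul_le_mul_of_nonneg_right (hA s) (norm_nonneg (aeval (γ s) p))]

lemma tracial_aeval_eq_of_lax (T : 𝔸 →L[ℝ] ℂ) (hT : ∀ a b, T (a * b) = T (b * a))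
    (hγ : ∀ t ∈ Icc (0 : ℝ) 1, HasDerivAt γ (A t * γ t - γ t * A t) t) (q : ℂ[X])
    {t : ℝ} (ht : t ∈ Icc (0 : ℝ) 1) : T (aeval (γ t) q) = T (aeval (γ 0) q) := by
  have hder : ∀ s ∈ Icc (0 : ℝ) 1, HasDerivAt (fun s => T (aeval (γ s) q)) 0 s := by
    intro s hs
    have h := T.hasFDerivAt.comp_hasDerivAt s (hasDerivAt_aeval_of_lax (hγ s hs) q)
    rwa [map_sub, hT, sub_self] at h
  exact constant_of_has_deriv_right_zero
    (fun s hs => (hder s hs).continuousAt.continuousWithinAt)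
    (fun s hs => (hder s (Ico_subset_Icc_self hs)).hasDerivWithinAt) t ht

open scoped Matrix.Norms.Frobenius

/-- The Lax equation preserves adjoint orbits of diagonal matrices. -/
lemma mem_adjointOrbit_of_lax {n : ℕ} {d : Fin n → ℂ} {γ A : ℝ → Matrix (Fin n) (Fin n) ℂ} {C : ℝ}
    (hA : ∀ t, ‖A t‖ ≤ C)
    (hγ : ∀ t ∈ Icc (0 : ℝ) 1, HasDerivAt γ (A t * γ t - γ t * A t) t)
    (h0 : γ 0 ∈ adjointOrbit n d) {t : ℝ} (ht : t ∈ Icc (0 : ℝ) 1) : γ t ∈ adjointOrbit n d := by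
  rw [mem_adjointOrbit_iff] at h0 ⊢
  refine ⟨aeval_eq_zero_of_lax hA hγ h0.1 ht, fun q => ?_⟩
  rw [← h0.2 q]
  exact tracial_aeval_eq_of_lax
    ((Matrix.traceLinearMap (Fin n) ℂ ℂ).restrictScalars ℝ).toContinuousLinearMap
    Matrix.trace_mul_comm hγ q ht

end Lax

section LowerBound

open Filter Topology
open scoped Matrix.Norms.Frobenius

lemma isDiag_of_commute_diagonal {n : ℕ} {D : Fin n → ℂ} (hD : Function.Injective D)
    {x : Matrix (Fin n) (Fin n) ℂ}
    (hx : x * Matrix.diagonal D - Matrix.diagonal D * x = 0) : x.IsDiag := by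
  intro i j hij
  have h := congrFun (congrFun hx i) j
  simp only [Matrix.sub_apply, Matrix.mul_diagonal, Matrix.diagonal_mul, Matrix.zero_apply] at h
  have h' : x i j * (D j - D i) = 0 := by linear_combination h
  exact (mul_eq_zero.1 h').resolve_right (sub_ne_zero.2 (hD.ne hij.symm))

lemma eq_zero_of_isDiag_of_det {n : ℕ} {z : Matrix (Fin n) (Fin n) ℂ} (hz : z.IsDiag)
    (hdet : ∀ w : ℂ, (Matrix.scalar (Fin n) w - z).det = w ^ n) : z = 0 := by
  have hz' : Matrix.diagonal z.diag = z := hz.diagonal_diag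
  have hentry : ∀ j, z j j = 0 := by
    intro j
    have h := hdet (z j j)
    rw [← hz', Matrix.scalar_apply, Matrix.diagonal_sub, Matrix.det_diagonal,
      Finset.prod_eq_zero (Finset.mem_univ j) (by simp)] at h
    simpa using eq_zero_of_pow_eq_zero h.symm
  rw [← hz']
  ext i j
  by_cases hij : i = j <;> simp [Matrix.diagonal, hij, hentry]

/-- Near a regular value of the height function, the commutator with a regular diagonal matrix
grows at least linearly on the orbit. -/
lemma exists_commutator_lower_bound {n : ℕ} (d : Fin n → ℂ) {D : Fin n → ℂ}
    (hD : Function.Injective D) {c : ℂ}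
    (hc : ∀ y ∈ adjointOrbit n d, y.IsDiag → (y * Matrix.diagonal D).trace ≠ c) :
    ∃ r > 0, ∃ η > 0, ∀ x ∈ adjointOrbit n d, ‖(x * Matrix.diagonal D).trace - c‖ < r →
      η * (1 + ‖x‖) ≤ ‖x * Matrix.diagonal D - Matrix.diagonal D * x‖ := by
  by_contra! hcon
  have hpos : ∀ k : ℕ, (0 : ℝ) < 1 / (k + 1) := fun k => by positivity
  choose x hxO hxc hxK using fun k : ℕ => hcon (1 / (k + 1)) (hpos k) (1 / (k + 1)) (hpos k)
  let s : ℕ → ℝ := fun k => (1 + ‖x k‖)⁻¹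
  let z : ℕ → Matrix (Fin n) (Fin n) ℂ := fun k => (s k : ℂ) • x k
  have hden : ∀ k, 0 < 1 + ‖x k‖ := fun k => by positivity
  have hs0 : ∀ k, 0 < s k := fun k => inv_pos.2 (hden k)
  have hzn : ∀ k, ‖z k‖ = 1 - s k := by
    intro k
    simp only [z, norm_smul, Complex.norm_real, Real.norm_eq_abs, abs_of_pos (hs0 k)]
    have := (hden k).ne'
    simp only [s]
    field_simp
    ring
  have : ProperSpace (Matrix (Fin n) (Fin n) ℂ) := FiniteDimensional.proper ℂ _
  have : FirstCountableTopology (Matrix (Fin n) (Fin n) ℂ) :=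
    inferInstanceAs (FirstCountableTopology (Fin n → Fin n → ℂ))
  have hcpt : IsCompact (Icc (0 : ℝ) 1 ×ˢ Metric.closedBall (0 : Matrix (Fin n) (Fin n) ℂ) 1) :=
    isCompact_Icc.prod (isCompact_closedBall _ _)
  obtain ⟨⟨S, Z⟩, -, φ, hφ, hlim⟩ := hcpt.tendsto_subseq (x := fun k => (s k, z k)) fun k => by
    have h1 := norm_nonneg (z k)
    rw [hzn] at h1
    refine ⟨⟨(hs0 k).le, by linarith⟩, ?_⟩
    rw [mem_closedBall_zero_iff, hzn]
    linarith [hs0 k]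
  have hS : Tendsto (fun k => s (φ k)) atTop (𝓝 S) := (continuous_fst.tendsto _).comp hlim
  have hZ : Tendsto (fun k => z (φ k)) atTop (𝓝 Z) := (continuous_snd.tendsto _).comp hlim
  have hinv : Tendsto (fun k => 1 / ((φ k : ℝ) + 1)) atTop (𝓝 0) :=
    tendsto_one_div_add_atTop_nhds_zero_nat.comp hφ.tendsto_atTop
  have hSc : Tendsto (fun k => (s (φ k) : ℂ)) atTop (𝓝 (S : ℂ)) :=
    (Complex.continuous_ofReal.tendsto _).comp hS
  have hK : Continuous fun y : Matrix (Fin n) (Fin n) ℂ =>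
      y * Matrix.diagonal D - Matrix.diagonal D * y := by fun_prop
  have hZK : Z * Matrix.diagonal D - Matrix.diagonal D * Z = 0 := by
    refine tendsto_nhds_unique ((hK.tendsto Z).comp hZ)
      (squeeze_zero_norm (fun k => ?_) hinv)
    have hzK : z (φ k) * Matrix.diagonal D - Matrix.diagonal D * z (φ k) =
        (s (φ k) : ℂ) • (x (φ k) * Matrix.diagonal D - Matrix.diagonal D * x (φ k)) := by
      simp only [z, smul_mul_assoc, mul_smul_comm, smul_sub]
    simp only [Function.comp_apply]
    rw [hzK, norm_smul, Complex.norm_real, Real.norm_eq_abs, abs_of_pos (hs0 _)]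
    calc s (φ k) * _ ≤ s (φ k) * (1 / (φ k + 1) * (1 + ‖x (φ k)‖)) :=
          mul_le_mul_of_nonneg_left (hxK _).le (hs0 _).le
      _ = 1 / (φ k + 1) := by
          have := (hden (φ k)).ne'
          simp only [s]
          field_simp
  have hZd : Z.IsDiag := isDiag_of_commute_diagonal hD hZK
  rcases eq_or_ne S 0 with hS0 | hS0
  · have hZ1 : ‖Z‖ = 1 := by
      refine tendsto_nhds_unique ((continuous_norm.tendsto Z).comp hZ) ?_
      simpa [Function.comp_def, hzn, hS0] using hS.const_sub 1
    have hdet : ∀ w : ℂ, (Matrix.scalar (Fin n) w - Z).det = w ^ n := by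
      intro w
      have hcont : Continuous fun y : Matrix (Fin n) (Fin n) ℂ =>
          (Matrix.scalar (Fin n) w - y).det := by fun_prop
      refine tendsto_nhds_unique ((hcont.tendsto Z).comp hZ) ?_
      simp only [Function.comp_def, z, det_sub_of_mem_adjointOrbit (hxO _)]
      have := tendsto_finsetProd (Finset.univ : Finset (Fin n)) fun i _ =>
        (hSc.mul_const (d i)).const_sub w
      simpa [hS0] using this
    rw [eq_zero_of_isDiag_of_det hZd hdet] at hZ1
    simp at hZ1
  · have hX : Tendsto (fun k => x (φ k)) atTop (𝓝 ((S : ℂ)⁻¹ • Z)) := by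
      have := (hSc.inv₀ (Complex.ofReal_ne_zero.2 hS0)).smul hZ
      refine this.congr fun k => ?_
      have : (s (φ k) : ℂ) ≠ 0 := Complex.ofReal_ne_zero.2 (hs0 _).ne'
      simp only [z, smul_smul, inv_mul_cancel₀ this, one_smul]
    refine hc _ ((isClosed_adjointOrbit n d).mem_of_tendsto hX (Eventually.of_forall fun k => hxO _))
      (hZd.smul _) ?_
    have hcont : Continuous fun y : Matrix (Fin n) (Fin n) ℂ => (y * Matrix.diagonal D).trace := by
      fun_prop
    refine tendsto_nhds_unique ((hcont.tendsto _).comp hX) ?_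
    rw [tendsto_iff_norm_sub_tendsto_zero]
    exact squeeze_zero (fun _ => norm_nonneg _) (fun k => (hxc (φ k)).le) hinv

end LowerBound

section Field

variable {E F : Type*} [NormedAddCommGroup E] [NormedAddCommGroup F] [NormedSpace ℝ F]

lemma exists_lipschitzWith_inv_smul {L : E → F} {m : E → ℝ} {KL Km : NNReal} {η B : ℝ}
    (hL : LipschitzWith KL L) (hm : LipschitzWith Km m) (hη : 0 < η) (hmη : ∀ x, η ≤ m x)
    (hB : ∀ x, ‖L x‖ ≤ B * m x) : ∃ K, LipschitzWith K fun x => (m x)⁻¹ • L x := by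
  have hB0 : 0 ≤ B := by
    have := (norm_nonneg _).trans (hB 0)
    exact nonneg_of_mul_nonneg_left this (hη.trans_le (hmη 0))
  refine ⟨_, LipschitzWith.of_dist_le' (K := η⁻¹ * KL + η⁻¹ * Km * B) fun x y => ?_⟩
  have hx := hη.trans_le (hmη x)
  have hy := hη.trans_le (hmη y)
  have hxi : (m x)⁻¹ ≤ η⁻¹ := inv_anti₀ hη (hmη x)
  have hsplit : (m x)⁻¹ • L x - (m y)⁻¹ • L y =
      (m x)⁻¹ • (L x - L y) + ((m x)⁻¹ * (m y - m x)) • ((m y)⁻¹ • L y) := by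
    rw [smul_smul, show (m x)⁻¹ * (m y - m x) * (m y)⁻¹ = (m x)⁻¹ - (m y)⁻¹ by field_simp,
      smul_sub, sub_smul]
    abel
  have h1 : ‖L x - L y‖ ≤ KL * dist x y := by simpa [dist_eq_norm] using hL.dist_le_mul x y
  have h2 : |m y - m x| ≤ Km * dist x y := by
    simpa [Real.dist_eq, abs_sub_comm] using hm.dist_le_mul x y
  have h3 : ‖(m y)⁻¹ • L y‖ ≤ B := by
    rw [norm_smul, norm_inv, Real.norm_eq_abs, abs_of_pos hy, inv_mul_le_iff₀ hy, mul_comm]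
    exact hB y
  rw [dist_eq_norm, hsplit]
  calc _ ≤ (m x)⁻¹ * ‖L x - L y‖ + (m x)⁻¹ * |m y - m x| * ‖(m y)⁻¹ • L y‖ := by
        refine (norm_add_le _ _).trans_eq ?_
        rw [norm_smul, norm_smul ((m x)⁻¹ * _), norm_mul, norm_inv, Real.norm_eq_abs,
          Real.norm_eq_abs, abs_of_pos hx]
    _ ≤ η⁻¹ * (KL * dist x y) + η⁻¹ * (Km * dist x y) * B := by gcongr
    _ = _ := by ring

lemma exists_lipschitzWith_mul {𝔸 : Type*} [NormedRing 𝔸] {f g : E → 𝔸} {Kf Kg : NNReal}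
    {Bf Bg : ℝ} (hf : LipschitzWith Kf f) (hg : LipschitzWith Kg g) (hBf : ∀ x, ‖f x‖ ≤ Bf)
    (hBg : ∀ x, ‖g x‖ ≤ Bg) : ∃ K, LipschitzWith K fun x => f x * g x := by
  refine ⟨_, LipschitzWith.of_dist_le' (K := Kf * Bg + Bf * Kg) fun x y => ?_⟩
  have hBf0 := (norm_nonneg _).trans (hBf x)
  have h1 : ‖f x - f y‖ ≤ Kf * dist x y := by simpa [dist_eq_norm] using hf.dist_le_mul x y
  have h2 : ‖g x - g y‖ ≤ Kg * dist x y := by simpa [dist_eq_norm] using hg.dist_le_mul x y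
  rw [dist_eq_norm, show f x * g x - f y * g y = (f x - f y) * g x + f y * (g x - g y) by
    noncomm_ring]
  calc _ ≤ ‖f x - f y‖ * ‖g x‖ + ‖f y‖ * ‖g x - g y‖ :=
        (norm_add_le _ _).trans (add_le_add (norm_mul_le _ _) (norm_mul_le _ _))
    _ ≤ Kf * dist x y * Bg + Bf * (Kg * dist x y) := by
        gcongr
        exacts [hBg x, hBf y]
    _ = _ := by ring

end Field

section Lift

open scoped Matrix Matrix.Norms.Frobenius

variable {n : ℕ}

local notation "Mat" => Matrix (Fin n) (Fin n) ℂ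

/-- The commutator of `x` with `diagonal D`. -/
def diagCommutator (D : Fin n → ℂ) (x : Mat) : Mat := x * Matrix.diagonal D - Matrix.diagonal D * x

/-- The size of `diagCommutator D x`, truncated from below by a positive function of linear
growth. -/
noncomputable def truncatedNorm (D : Fin n → ℂ) (η : ℝ) (x : Mat) : ℝ :=
  max ‖diagCommutator D x‖ (η * (1 + ‖x‖))

/-- The generator of the Lax equation that lifts the constant vector field `w` on `ℂ`. -/
noncomputable def liftGenerator (D : Fin n → ℂ) (η : ℝ) (w : ℂ) (x : Mat) : Mat :=
  (truncatedNorm D η x)⁻¹ • ((truncatedNorm D η x)⁻¹ • (w • (diagCommutator D x)ᴴ))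

/-- A vector field tangent to all adjoint orbits that lifts the constant vector field `w` along
the height function wherever the truncation in `truncatedNorm` is inactive. -/
noncomputable def liftField (D : Fin n → ℂ) (η : ℝ) (w : ℂ) (x : Mat) : Mat :=
  liftGenerator D η w x * x - x * liftGenerator D η w x

variable {D : Fin n → ℂ} {η : ℝ}

lemma liftField_neg (w : ℂ) : liftField D η (-w) = -liftField D η w := by
  funext x
  simp only [liftField, liftGenerator, neg_smul, smul_neg, neg_mul, mul_neg, Pi.neg_apply]
  abel

lemma le_truncatedNorm (hη : 0 < η) (x : Mat) : η ≤ truncatedNorm D η x :=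
  le_max_of_le_right (by nlinarith [norm_nonneg x])

lemma norm_diagCommutator_le (x : Mat) : ‖diagCommutator D x‖ ≤ truncatedNorm D η x :=
  le_max_left _ _

lemma norm_le_truncatedNorm (hη : 0 < η) (x : Mat) : ‖x‖ ≤ η⁻¹ * truncatedNorm D η x := by
  rw [le_inv_mul_iff₀ hη]
  exact le_max_of_le_right (by nlinarith)

lemma exists_lipschitzWith_diagCommutator (D : Fin n → ℂ) :
    ∃ K, LipschitzWith K (diagCommutator D) := by
  refine ⟨_, LipschitzWith.of_dist_le' (K := 2 * ‖Matrix.diagonal D‖) fun x y => ?_⟩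
  rw [dist_eq_norm, dist_eq_norm, show diagCommutator D x - diagCommutator D y =
    (x - y) * Matrix.diagonal D - Matrix.diagonal D * (x - y) by
      simp only [diagCommutator]; noncomm_ring]
  have h1 := norm_mul_le (x - y) (Matrix.diagonal D)
  have h2 := norm_mul_le (Matrix.diagonal D) (x - y)
  have h3 := norm_sub_le ((x - y) * Matrix.diagonal D) (Matrix.diagonal D * (x - y))
  linarith

lemma exists_lipschitzWith_truncatedNorm (D : Fin n → ℂ) (hη : 0 < η) :
    ∃ K, LipschitzWith K (truncatedNorm D η) := by
  obtain ⟨K, hK⟩ := exists_lipschitzWith_diagCommutator D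
  have h : LipschitzWith η.toNNReal fun x : Mat => η * (1 + ‖x‖) := by
    refine LipschitzWith.of_dist_le' fun x y => ?_
    rw [Real.dist_eq, dist_eq_norm, show η * (1 + ‖x‖) - η * (1 + ‖y‖) = η * (‖x‖ - ‖y‖) by ring,
      abs_mul, abs_of_pos hη]
    gcongr
    exact abs_norm_sub_norm_le x y
  exact ⟨_, (lipschitzWith_one_norm.comp hK).max h⟩

lemma norm_smul_conjTranspose_le (w : ℂ) (x : Mat) :
    ‖w • (diagCommutator D x)ᴴ‖ ≤ ‖w‖ * truncatedNorm D η x := by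
  rw [norm_smul, Matrix.frobenius_norm_conjTranspose]
  exact mul_le_mul_of_nonneg_left (norm_diagCommutator_le x) (norm_nonneg w)

lemma norm_inv_truncatedNorm_smul_le (hη : 0 < η) {x y : Mat} {B : ℝ}
    (h : ‖y‖ ≤ B * truncatedNorm D η x) : ‖(truncatedNorm D η x)⁻¹ • y‖ ≤ B := by
  have hx := hη.trans_le (le_truncatedNorm (D := D) hη x)
  rw [norm_smul, norm_inv, Real.norm_eq_abs, abs_of_pos hx, inv_mul_le_iff₀ hx, mul_comm]
  exact h

lemma norm_liftGenerator_le (hη : 0 < η) (w : ℂ) (x : Mat) :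
    ‖liftGenerator D η w x‖ ≤ η⁻¹ * ‖w‖ := by
  refine norm_inv_truncatedNorm_smul_le hη
    ((norm_inv_truncatedNorm_smul_le hη (norm_smul_conjTranspose_le w x)).trans ?_)
  rw [mul_right_comm]
  refine le_mul_of_one_le_left (norm_nonneg w) ?_
  rw [le_inv_mul_iff₀ hη, mul_one]
  exact le_truncatedNorm hη x

lemma exists_lipschitzWith_liftField (D : Fin n → ℂ) (hη : 0 < η) (w : ℂ) :
    (∃ K, LipschitzWith K (liftField D η w)) ∧ ∃ M : NNReal, ∀ x, ‖liftField D η w x‖ ≤ M := by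
  obtain ⟨Kc, hKc⟩ := exists_lipschitzWith_diagCommutator D
  obtain ⟨Km, hKm⟩ := exists_lipschitzWith_truncatedNorm D hη
  let a : Mat → Mat := fun x => (truncatedNorm D η x)⁻¹ • (w • (diagCommutator D x)ᴴ)
  let b : Mat → Mat := fun x => (truncatedNorm D η x)⁻¹ • x
  have hab : liftField D η w = fun x => a x * b x - b x * a x := by
    funext x
    simp only [liftField, liftGenerator, a, b, smul_mul_assoc, mul_smul_comm]
    rw [smul_comm w]
  have hw : LipschitzWith (‖w‖ * Kc).toNNReal fun x => w • (diagCommutator D x)ᴴ := by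
    refine LipschitzWith.of_dist_le' fun x y => ?_
    rw [dist_eq_norm, ← smul_sub, ← Matrix.conjTranspose_sub, norm_smul,
      Matrix.frobenius_norm_conjTranspose, ← dist_eq_norm, mul_assoc]
    exact mul_le_mul_of_nonneg_left (hKc.dist_le_mul x y) (norm_nonneg w)
  obtain ⟨Ka, hKa⟩ : ∃ K, LipschitzWith K a := exists_lipschitzWith_inv_smul hw hKm hη
    (le_truncatedNorm hη) (norm_smul_conjTranspose_le w)
  obtain ⟨Kb, hKb⟩ : ∃ K, LipschitzWith K b := exists_lipschitzWith_inv_smul LipschitzWith.id hKm hη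
    (le_truncatedNorm hη) (norm_le_truncatedNorm hη)
  have hBa : ∀ x, ‖a x‖ ≤ ‖w‖ := fun x =>
    norm_inv_truncatedNorm_smul_le hη (norm_smul_conjTranspose_le w x)
  have hBb : ∀ x, ‖b x‖ ≤ η⁻¹ := fun x =>
    norm_inv_truncatedNorm_smul_le hη (norm_le_truncatedNorm hη x)
  obtain ⟨K₁, h₁⟩ := exists_lipschitzWith_mul hKa hKb hBa hBb
  obtain ⟨K₂, h₂⟩ := exists_lipschitzWith_mul hKb hKa hBb hBa
  rw [hab]
  refine ⟨⟨_, h₁.sub h₂⟩, (2 * (‖w‖ * η⁻¹)).toNNReal, fun x => ?_⟩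
  rw [Real.coe_toNNReal _ (by positivity)]
  calc _ ≤ ‖a x‖ * ‖b x‖ + ‖b x‖ * ‖a x‖ :=
        (norm_sub_le _ _).trans (add_le_add (norm_mul_le _ _) (norm_mul_le _ _))
    _ = 2 * (‖a x‖ * ‖b x‖) := by ring
    _ ≤ _ := by
      gcongr
      exacts [hBa x, hBb x]

lemma trace_conjTranspose_mul_self_eq (x : Mat) : (xᴴ * x).trace = (‖x‖ ^ 2 : ℝ) := by
  have hn : ‖x‖ ^ 2 = ∑ i, ∑ j, ‖x i j‖ ^ 2 := by
    rw [Matrix.frobenius_norm_def, ← Real.sqrt_eq_rpow, Real.sq_sqrt (by positivity)]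
    simp
  rw [hn, Finset.sum_comm]
  simp [Matrix.trace, Matrix.mul_apply, Complex.conj_mul']

lemma trace_liftField_mul (w : ℂ) (x : Mat) :
    (liftField D η w x * Matrix.diagonal D).trace =
      ((‖diagCommutator D x‖ / truncatedNorm D η x) ^ 2 : ℝ) * w := by
  have h1 : (liftField D η w x * Matrix.diagonal D).trace =
      (liftGenerator D η w x * diagCommutator D x).trace := by
    simp only [liftField, diagCommutator, sub_mul, mul_sub, Matrix.trace_sub]
    rw [mul_assoc, mul_assoc, Matrix.trace_mul_comm x, mul_assoc]
  rw [h1, liftGenerator, smul_mul_assoc, smul_mul_assoc, smul_mul_assoc, Matrix.trace_smul,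
    Matrix.trace_smul, Matrix.trace_smul, trace_conjTranspose_mul_self_eq]
  simp only [Complex.real_smul, smul_eq_mul]
  push_cast
  ring

/-- Integral curves of `liftField D η w` in an orbit move the height by exactly `w`, provided the
truncation is inactive near the starting level. -/
lemma liftField_curve_end {d : Fin n → ℂ} (hη : 0 < η) {c₀ w : ℂ} {r : ℝ}
    (hbound : ∀ x ∈ adjointOrbit n d, ‖(x * Matrix.diagonal D).trace - c₀‖ < r →
      η * (1 + ‖x‖) ≤ ‖diagCommutator D x‖)
    {γ : ℝ → Mat} (hγ : IsUnitIntegralCurve (liftField D η w) γ) (h0 : γ 0 ∈ adjointOrbit n d)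
    (hr : ‖(γ 0 * Matrix.diagonal D).trace - c₀‖ + ‖w‖ < r) :
    γ 1 ∈ adjointOrbit n d ∧
      (γ 1 * Matrix.diagonal D).trace = (γ 0 * Matrix.diagonal D).trace + w := by
  have hO : ∀ t ∈ Icc (0 : ℝ) 1, γ t ∈ adjointOrbit n d := fun t ht =>
    mem_adjointOrbit_of_lax (A := fun t => liftGenerator D η w (γ t))
      (fun t => norm_liftGenerator_le hη w (γ t)) hγ h0 ht
  refine ⟨hO 1 (by simp), ?_⟩
  let T : Mat →L[ℝ] ℂ := (((Matrix.traceLinearMap (Fin n) ℂ ℂ).restrictScalars ℝ) ∘ₗ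
    (LinearMap.mulRight ℝ (Matrix.diagonal D))).toContinuousLinearMap
  have hder : ∀ t ∈ Icc (0 : ℝ) 1, HasDerivAt (fun t => (γ t * Matrix.diagonal D).trace)
      (((‖diagCommutator D (γ t)‖ / truncatedNorm D η (γ t)) ^ 2 : ℝ) * w) t := by
    intro t ht
    rw [← trace_liftField_mul]
    exact T.hasFDerivAt.comp_hasDerivAt t (hγ t ht)
  have hpos : ∀ x : Mat, 0 < truncatedNorm D η x := fun x => hη.trans_le (le_truncatedNorm hη x)
  have hclose : ∀ t ∈ Icc (0 : ℝ) 1, ‖(γ t * Matrix.diagonal D).trace -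
      (γ 0 * Matrix.diagonal D).trace‖ ≤ ‖w‖ := by
    intro t ht
    have h := norm_image_sub_le_of_norm_deriv_le_segment' (C := ‖w‖)
      (fun s hs => (hder s hs).hasDerivWithinAt) (fun s _ => ?_) t ht
    · refine h.trans (mul_le_of_le_one_right (norm_nonneg w) ?_)
      linarith [ht.2]
    · rw [norm_mul, Complex.norm_real, Real.norm_eq_abs, abs_of_nonneg (by positivity)]
      refine mul_le_of_le_one_left (norm_nonneg w) (pow_le_one₀ ?_ ?_)
      · exact div_nonneg (norm_nonneg _) (hpos _).le
      · exact (div_le_one (hpos _)).2 (norm_diagCommutator_le _)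
  have hder' : ∀ t ∈ Icc (0 : ℝ) 1,
      HasDerivAt (fun t : ℝ => (γ t * Matrix.diagonal D).trace - t • w) 0 t := by
    intro t ht
    have hm : truncatedNorm D η (γ t) = ‖diagCommutator D (γ t)‖ := by
      refine max_eq_left (hbound _ (hO t ht) (lt_of_le_of_lt ?_ hr))
      rw [add_comm]
      exact (norm_sub_le_norm_sub_add_norm_sub _ _ _).trans (by gcongr; exact hclose t ht)
    have h := (hder t ht).sub ((hasDerivAt_id t).smul_const w)
    rw [← hm, div_self (hpos _).ne'] at h
    simpa using! h
  have hconst := constant_of_has_deriv_right_zero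
    (fun s hs => (hder' s hs).continuousAt.continuousWithinAt)
    (fun s hs => (hder' s (Ico_subset_Icc_self hs)).hasDerivWithinAt) 1 (by simp)
  simp only [one_smul, zero_smul, sub_zero] at hconst
  rw [← hconst, sub_add_cancel]

/-- The homeomorphism type of the level sets of the height function is locally constant at a
regular value. -/
lemma eventually_nonempty_homeomorph_level {d : Fin n → ℂ} (hD : Function.Injective D) {c₀ : ℂ}
    (hc : ∀ y ∈ adjointOrbit n d, y.IsDiag → (y * Matrix.diagonal D).trace ≠ c₀) :
    ∀ᶠ c in nhds c₀, Nonempty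
      ({x | x ∈ adjointOrbit n d ∧ (x * Matrix.diagonal D).trace = c₀} ≃ₜ
        {x | x ∈ adjointOrbit n d ∧ (x * Matrix.diagonal D).trace = c}) := by
  obtain ⟨r, hr, η, hη, hbound⟩ := exists_commutator_lower_bound d hD hc
  filter_upwards [Metric.ball_mem_nhds c₀ (half_pos hr)] with c hcr
  rw [Metric.mem_ball, dist_eq_norm] at hcr
  obtain ⟨⟨K, hK⟩, M, hM⟩ := exists_lipschitzWith_liftField D hη (c - c₀)
  refine nonempty_homeomorph_of_unit_flow hK hM ?_ ?_
  · rintro γ hγ ⟨h0, h0c⟩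
    obtain ⟨h1, h1c⟩ := liftField_curve_end hη hbound hγ h0 (by
      rw [h0c, sub_self, norm_zero]; linarith)
    exact ⟨h1, by rw [h1c, h0c]; ring⟩
  · rintro γ hγ ⟨h0, h0c⟩
    rw [← liftField_neg] at hγ
    obtain ⟨h1, h1c⟩ := liftField_curve_end hη hbound hγ h0 (by
      rw [h0c, norm_neg]; linarith)
    exact ⟨h1, by rw [h1c, h0c]; ring⟩

end Lift

lemma finite_isDiag_adjointOrbit (n : ℕ) (d : Fin n → ℂ) :
    {y | y ∈ adjointOrbit n d ∧ y.IsDiag}.Finite := by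
  have hfin : (Set.pi univ fun _ : Fin n => range d).Finite :=
    Set.Finite.pi fun _ => finite_range d
  refine (hfin.image Matrix.diagonal).subset ?_
  rintro y ⟨hy, hdiag⟩
  refine ⟨y.diag, fun i _ => ?_, hdiag.diagonal_diag⟩
  have h := det_sub_of_mem_adjointOrbit hy (y i i) 1
  rw [one_smul, ← hdiag.diagonal_diag, Matrix.scalar_apply, Matrix.diagonal_sub,
    Matrix.det_diagonal, Finset.prod_eq_zero (Finset.mem_univ i) (by simp), eq_comm,
    Finset.prod_eq_zero_iff] at h
  obtain ⟨j, -, hj⟩ := h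
  exact ⟨j, by simpa [sub_eq_zero, eq_comm] using hj⟩

/-- Let `H₀ = diagonal d` be a traceless complex diagonal matrix, `H = diagonal h` a
regular real diagonal matrix (pairwise distinct entries), and `f_H(x) = trace (x * H)`
the height function on the adjoint orbit `O(H₀)`.  If `c₁, c₂` are regular values
(values not attained by `f_H` at any diagonal matrix of the orbit), then the level sets
`f_H⁻¹(c₁)` and `f_H⁻¹(c₂)` in `O(H₀)` are homeomorphic. -/
theorem regular_levels_homeomorphic
    (n : ℕ) (d : Fin n → ℂ) (htr : Matrix.trace (Matrix.diagonal d) = 0)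
    (h : Fin n → ℝ) (hreg : Function.Injective h)
    (c₁ c₂ : ℂ)
    (hc₁ : ∀ y ∈ adjointOrbit n d, y.IsDiag →
      Matrix.trace (y * Matrix.diagonal (fun i => (h i : ℂ))) ≠ c₁)
    (hc₂ : ∀ y ∈ adjointOrbit n d, y.IsDiag →
      Matrix.trace (y * Matrix.diagonal (fun i => (h i : ℂ))) ≠ c₂) :
    Nonempty
      (({x | x ∈ adjointOrbit n d ∧
          Matrix.trace (x * Matrix.diagonal (fun i => (h i : ℂ))) = c₁} :
            Set (Matrix (Fin n) (Fin n) ℂ)) ≃ₜ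
       ({x | x ∈ adjointOrbit n d ∧
          Matrix.trace (x * Matrix.diagonal (fun i => (h i : ℂ))) = c₂} :
            Set (Matrix (Fin n) (Fin n) ℂ))) := by

  have hD : Function.Injective fun i => (h i : ℂ) := Complex.ofReal_injective.comp hreg
  let R : Set ℂ := ((fun y => Matrix.trace (y * Matrix.diagonal (fun i => (h i : ℂ)))) ''
    {y | y ∈ adjointOrbit n d ∧ y.IsDiag})ᶜ
  have hmem : ∀ c, c ∈ R ↔ ∀ y ∈ adjointOrbit n d, y.IsDiag →
      Matrix.trace (y * Matrix.diagonal (fun i => (h i : ℂ))) ≠ c := by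
    simp [R]
  have hR : IsPreconnected R :=
    (((finite_isDiag_adjointOrbit n d).image _).countable.isConnected_compl_of_one_lt_rank
      (by simp)).isPreconnected
  refine hR.induction₂ (fun a b => Nonempty
      (({x | x ∈ adjointOrbit n d ∧
          Matrix.trace (x * Matrix.diagonal (fun i => (h i : ℂ))) = a} :
            Set (Matrix (Fin n) (Fin n) ℂ)) ≃ₜ
       ({x | x ∈ adjointOrbit n d ∧
          Matrix.trace (x * Matrix.diagonal (fun i => (h i : ℂ))) = b} :
            Set (Matrix (Fin n) (Fin n) ℂ)))) (fun c hc => ?_) ?_ ?_ ((hmem _).2 hc₁) ((hmem _).2 hc₂)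
  · exact (eventually_nonempty_homeomorph_level hD ((hmem c).1 hc)).filter_mono nhdsWithin_le_nhds
  · rintro a b c - - - ⟨e⟩ ⟨e'⟩
    exact ⟨e.trans e'⟩
  · rintro a b - - ⟨e⟩
    exact ⟨e.symm⟩
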